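/- arXiv:2603.26561 — 5 statements merged into one kernel-verified Lean document; each statement's English description precedes it below -/
import Mathlib

section
/- Let B and D be complex M×K matrices, and set A = B·Bᴴ and C = D·Dᴴ (where ᴴ denotes conjugate transpose). Let q, p : ℝ → ℂ^M be differentiable functions satisfying q'(t) = C·p(t) and p'(t) = −A·q(t) for all t. Define u(t) = i·Bᴴ·q(t) and v(t) = Dᴴ·p(t). Then u'(t) = i·(BᴴD)·v(t) and v'(t) = i·(DᴴB)·u(t); equivalently, the combined vector (u, v) satisfies the Schrödinger-type equation ∂_t (u,v) = i·H₀·(u,v) where H₀ is the Hermitian block matrix [[0, BᴴD],[DᴴB, 0]]. Consequently, ‖u(t)‖² + ‖v(t)‖² is constant in t. -/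
open Matrix

theorem HasDerivAt.const_mulVec {m n : Type*} [Fintype m] [Fintype n] (A : Matrix m n ℂ)
    {f : ℝ → n → ℂ} {f' : n → ℂ} {t : ℝ} (hf : HasDerivAt f f' t) :
    HasDerivAt (fun s => A *ᵥ f s) (A *ᵥ f') t := by
  rw [hasDerivAt_pi] at hf ⊢
  exact fun i => HasDerivAt.fun_sum fun j _ => (hf j).const_mul (A i j)

theorem HasDerivAt.star_dotProduct_self {n : Type*} [Fintype n]
    {f : ℝ → n → ℂ} {f' : n → ℂ} {t : ℝ} (hf : HasDerivAt f f' t) :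
    HasDerivAt (fun s => star (f s) ⬝ᵥ f s) (star f' ⬝ᵥ f t + star (f t) ⬝ᵥ f') t := by
  rw [hasDerivAt_pi] at hf
  simp only [dotProduct, ← Finset.sum_add_distrib]
  exact HasDerivAt.fun_sum fun i _ => (hf i).star.mul (hf i)

theorem Complex.star_dotProduct_self_eq_sum_norm_sq {n : Type*} [Fintype n] (x : n → ℂ) :
    star x ⬝ᵥ x = ((∑ i, ‖x i‖ ^ 2 : ℝ) : ℂ) := by
  simp [dotProduct, Complex.conj_mul']

/-- The flow of `u' = i G v`, `v' = i Gᴴ u` preserves `‖u‖² + ‖v‖²`. -/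
theorem sum_norm_sq_add_sum_norm_sq_eq_of_hasDerivAt {m n : Type*} [Fintype m] [Fintype n]
    (G : Matrix m n ℂ) {u : ℝ → m → ℂ} {v : ℝ → n → ℂ}
    (hu : ∀ t, HasDerivAt u (Complex.I • G *ᵥ v t) t)
    (hv : ∀ t, HasDerivAt v (Complex.I • Gᴴ *ᵥ u t) t) (s t : ℝ) :
    (∑ i, ‖u s i‖ ^ 2) + (∑ i, ‖v s i‖ ^ 2) = (∑ i, ‖u t i‖ ^ 2) + (∑ i, ‖v t i‖ ^ 2) := by
  have key : ∀ r, HasDerivAt (fun r => star (u r) ⬝ᵥ u r + star (v r) ⬝ᵥ v r) 0 r := by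
    intro r
    refine ((hu r).star_dotProduct_self.add (hv r).star_dotProduct_self).congr_deriv ?_
    simp only [star_smul, star_mulVec, conjTranspose_conjTranspose, smul_dotProduct,
      dotProduct_smul, ← dotProduct_mulVec, smul_eq_mul, Complex.star_def, Complex.conj_I]
    ring
  have h := is_const_of_deriv_eq_zero (fun r => (key r).differentiableAt)
    (fun r => (key r).deriv) s t
  simp only [Complex.star_dotProduct_self_eq_sum_norm_sq] at h
  exact_mod_cast h

/-- For complex matrices `B`, `D` with `A = B Bᴴ`, `C = D Dᴴ`, and trajectories satisfying
`q' = C p`, `p' = -A q`, the generalized coordinates `u = i Bᴴ q` and `v = Dᴴ p` satisfy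
the Schrödinger-type equations `u' = i (Bᴴ D) v`, `v' = i (Dᴴ B) u`, generated by the
Hermitian block matrix `[[0, BᴴD],[DᴴB, 0]]`; consequently `‖u‖² + ‖v‖²` is constant. -/
theorem generalized_coordinates_unitary_dynamics (M K : ℕ)
    (B D : Matrix (Fin M) (Fin K) ℂ)
    (q p : ℝ → Fin M → ℂ)
    (hq : ∀ t : ℝ, HasDerivAt q ((D * Dᴴ).mulVec (p t)) t)
    (hp : ∀ t : ℝ, HasDerivAt p (-((B * Bᴴ).mulVec (q t))) t)
    (u v : ℝ → Fin K → ℂ)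
    (hu : ∀ t : ℝ, u t = Complex.I • (Bᴴ).mulVec (q t))
    (hv : ∀ t : ℝ, v t = (Dᴴ).mulVec (p t)) :
    (∀ t : ℝ, HasDerivAt u (Complex.I • (Bᴴ * D).mulVec (v t)) t) ∧
    (∀ t : ℝ, HasDerivAt v (Complex.I • (Dᴴ * B).mulVec (u t)) t) ∧
    (∀ s t : ℝ,
      (∑ i, ‖u s i‖ ^ 2) + (∑ i, ‖v s i‖ ^ 2) =
        (∑ i, ‖u t i‖ ^ 2) + (∑ i, ‖v t i‖ ^ 2)) := by
  obtain rfl : u = fun t => Complex.I • Bᴴ *ᵥ q t := funext hu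
  obtain rfl : v = fun t => Dᴴ *ᵥ p t := funext hv
  have hu' : ∀ t : ℝ, HasDerivAt (fun t => Complex.I • Bᴴ *ᵥ q t)
      (Complex.I • (Bᴴ * D) *ᵥ (Dᴴ *ᵥ p t)) t := fun t => by
    refine (((hq t).const_mulVec Bᴴ).const_smul Complex.I).congr_deriv ?_
    simp only [mulVec_mulVec, Matrix.mul_assoc]
  have hv' : ∀ t : ℝ, HasDerivAt (fun t => Dᴴ *ᵥ p t)
      (Complex.I • (Dᴴ * B) *ᵥ (Complex.I • Bᴴ *ᵥ q t)) t := fun t => by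
    simpa only [mulVec_smul, smul_smul, Complex.I_mul_I, neg_one_smul, mulVec_neg,
      mulVec_mulVec, Matrix.mul_assoc] using (hp t).const_mulVec Dᴴ
  refine ⟨hu', hv', sum_norm_sq_add_sum_norm_sq_eq_of_hasDerivAt (Bᴴ * D) hu' fun t => ?_⟩
  simpa only [conjTranspose_mul, conjTranspose_conjTranspose] using hv' t
end

section
/- Let L ≥ 0, set N = L+2, let β and κ > 0 be real numbers, and let X₁ be the N×N real symmetric tridiagonal matrix with diagonal entries 4 except for the (N,N) entry which equals 4 − β², and super- /sub-diagonal entries −1. Let v be the vector with entries v_l = sinh(l·κ), l = 1,…,N. Then X₁·v = (4 − 2·cosh κ)·v holds if and only if β² = cosh κ + sinh κ · coth(N·κ). -/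
open Matrix

/-- A row of a tridiagonal matrix with off-diagonal entries `-1`, applied to the vector
`(s 1, …, s N)` with the boundary value `s 0 = 0`. -/
theorem sum_tridiagonal_row_mul (N i : ℕ) (hi : i < N) (d : ℝ) (s : ℕ → ℝ) (hs : s 0 = 0) :
    ∑ j ∈ Finset.range N,
        (if i = j then d else if i + 1 = j ∨ j + 1 = i then -1 else 0) * s (j + 1) =
      d * s (i + 1) - s i - if i + 1 < N then s (i + 2) else 0 := by
  have hsplit : ∀ j, (if i = j then d else if i + 1 = j ∨ j + 1 = i then -1 else 0) * s (j + 1) =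
      (if i = j then d * s (j + 1) else 0) - (if j + 1 = i then s (j + 1) else 0) -
        (if i + 1 = j then s (j + 1) else 0) := by
    intro j
    split_ifs <;> first | omega | ring
  have hlower : ∑ j ∈ Finset.range N, (if j + 1 = i then s (j + 1) else 0) = s i := by
    cases i with
    | zero => simp [hs]
    | succ k =>
      have hk : k < N := by omega
      simp [hk]
  simp only [hsplit, Finset.sum_sub_distrib, hlower, Finset.sum_ite_eq, Finset.mem_range, hi,
    if_true]

/-- The three-term recurrence `sinh ((x + 1) κ) + sinh ((x - 1) κ) = 2 cosh κ sinh (x κ)`. -/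
theorem sinh_succ_mul_add_sinh_pred_mul (x κ : ℝ) :
    Real.sinh ((x + 1) * κ) + Real.sinh ((x - 1) * κ) =
      2 * Real.cosh κ * Real.sinh (x * κ) := by
  rw [add_mul, sub_mul, one_mul, Real.sinh_add, Real.sinh_sub]
  ring

/-- For the perturbed clock matrix `X₁` of size `N = L+2` (tridiagonal, diagonal `4`
except the last diagonal entry `4 - β²`, off-diagonal `-1`), the vector with entries
`sinh (l κ)` is an eigenvector with eigenvalue `4 - 2 cosh κ` if and only if the
quantization condition `β² = cosh κ + sinh κ · coth ((L+2) κ)` holds. -/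
theorem bound_state_quantization_condition (L : ℕ) (β κ : ℝ) (hκ : 0 < κ)
    (X₁ : Matrix (Fin (L + 2)) (Fin (L + 2)) ℝ)
    (hX : ∀ l l' : Fin (L + 2), X₁ l l' =
      if l = l' then (if l.val = L + 1 then 4 - β ^ 2 else 4)
      else if l.val + 1 = l'.val ∨ l'.val + 1 = l.val then -1 else 0)
    (v : Fin (L + 2) → ℝ)
    (hv : ∀ l : Fin (L + 2), v l = Real.sinh ((l.val + 1) * κ)) :
    X₁.mulVec v = (4 - 2 * Real.cosh κ) • v ↔
      β ^ 2 = Real.cosh κ +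
        Real.sinh κ * (Real.cosh (((L : ℝ) + 2) * κ) / Real.sinh (((L : ℝ) + 2) * κ)) := by
  set s : ℕ → ℝ := fun n => Real.sinh (n * κ) with hs
  have hrow : ∀ l : Fin (L + 2), X₁.mulVec v l =
      (if l.val = L + 1 then 4 - β ^ 2 else 4) * s (l.val + 1) - s l.val -
        if l.val + 1 < L + 2 then s (l.val + 2) else 0 := by
    intro l
    rw [← sum_tridiagonal_row_mul (L + 2) l.val l.isLt _ s (by simp [hs]), Finset.sum_range]
    simp only [Matrix.mulVec, dotProduct]
    refine Finset.sum_congr rfl fun j _ => ?_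
    simp [hX, hv, hs, Fin.ext_iff]
  have hrec : ∀ n : ℕ, s (n + 2) + s n = 2 * Real.cosh κ * s (n + 1) := by
    intro n
    have h := sinh_succ_mul_add_sinh_pred_mul ((n : ℝ) + 1) κ
    simp only [hs]
    push_cast
    convert h using 4 <;> ring
  have hvs : ∀ l : Fin (L + 2), v l = s (l.val + 1) := by
    intro l
    simp [hv, hs]
  have hpos : 0 < Real.sinh (((L : ℝ) + 2) * κ) := Real.sinh_pos_iff.mpr (by positivity)
  have hlast : s (L + 1 + 1) = Real.sinh (((L : ℝ) + 2) * κ) := by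
    simp only [hs]
    push_cast
    ring_nf
  have hnext : s (L + 1 + 2) = Real.sinh (((L : ℝ) + 2) * κ) * Real.cosh κ +
      Real.cosh (((L : ℝ) + 2) * κ) * Real.sinh κ := by
    rw [← Real.sinh_add]
    simp only [hs]
    push_cast
    ring_nf
  have hcond : β ^ 2 = Real.cosh κ +
        Real.sinh κ * (Real.cosh (((L : ℝ) + 2) * κ) / Real.sinh (((L : ℝ) + 2) * κ)) ↔
      β ^ 2 * s (L + 1 + 1) = s (L + 1 + 2) := by
    rw [hlast, hnext, ← eq_div_iff hpos.ne']
    have : Real.cosh κ +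
        Real.sinh κ * (Real.cosh (((L : ℝ) + 2) * κ) / Real.sinh (((L : ℝ) + 2) * κ)) =
        (Real.sinh (((L : ℝ) + 2) * κ) * Real.cosh κ +
          Real.cosh (((L : ℝ) + 2) * κ) * Real.sinh κ) / Real.sinh (((L : ℝ) + 2) * κ) := by
      field_simp
    rw [this]
  rw [hcond]
  constructor
  · intro h
    have hl := congrFun h (Fin.last (L + 1))
    rw [hrow, Pi.smul_apply, hvs, smul_eq_mul] at hl
    simp only [Fin.val_last, if_true, lt_irrefl, if_false] at hl
    linarith [hrec (L + 1)]
  · intro h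
    funext l
    rw [hrow, Pi.smul_apply, hvs, smul_eq_mul]
    by_cases hl : l.val = L + 1
    · simp only [hl, if_true, lt_irrefl, if_false]
      linarith [hrec (L + 1)]
    · rw [if_neg hl, if_pos (by omega)]
      linarith [hrec l.val]
end

section
/- Let L ≥ 0 be an integer, let κ > 0 and β be real numbers satisfying the quantization condition β² = cosh κ + sinh κ · coth((L+2)·κ). Then cosh κ ≥ β²/2, and consequently the eigenvalue α₁ = 4 − 2·cosh κ satisfies α₁ ≤ 4 − β². In particular, if β > 2 then α₁ < 0 and is separated from zero by the constant β² − 4. -/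
/-- Multiplied out, `tanh x ≤ tanh y` for `x ≤ y`. -/
theorem Real.sinh_mul_cosh_le_cosh_mul_sinh {x y : ℝ} (h : x ≤ y) :
    Real.sinh x * Real.cosh y ≤ Real.cosh x * Real.sinh y := by
  have := Real.sinh_nonneg_iff.mpr (sub_nonneg.mpr h)
  rw [Real.sinh_sub] at this
  linarith

/-- If `κ > 0` satisfies the quantization condition
`β² = cosh κ + sinh κ · coth ((L+2) κ)`, then `cosh κ ≥ β²/2`, hence the eigenvalue
`α₁ = 4 - 2 cosh κ` satisfies `α₁ ≤ 4 - β²`; in particular, if `β > 2` then `α₁ < 0`. -/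
theorem bound_state_eigenvalue_bound (L : ℕ) (κ β : ℝ) (hκ : 0 < κ)
    (hquant : β ^ 2 = Real.cosh κ +
      Real.sinh κ * (Real.cosh (((L : ℝ) + 2) * κ) / Real.sinh (((L : ℝ) + 2) * κ))) :
    β ^ 2 / 2 ≤ Real.cosh κ ∧
    4 - 2 * Real.cosh κ ≤ 4 - β ^ 2 ∧
    (2 < β → 4 - 2 * Real.cosh κ < 0) := by
  have hle : κ ≤ ((L : ℝ) + 2) * κ :=
    le_mul_of_one_le_left hκ.le (by linarith [L.cast_nonneg (α := ℝ)])
  have hcoth : Real.sinh κ *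
      (Real.cosh (((L : ℝ) + 2) * κ) / Real.sinh (((L : ℝ) + 2) * κ)) ≤ Real.cosh κ := by
    rw [← mul_div_assoc, div_le_iff₀ (Real.sinh_pos_iff.mpr (hκ.trans_le hle))]
    exact Real.sinh_mul_cosh_le_cosh_mul_sinh hle
  refine ⟨by linarith, by linarith, fun hβ => ?_⟩
  nlinarith
end

section
/- Let N ≥ 1 be an integer. The function f(κ) = cosh κ + sinh κ · coth(N·κ) is strictly monotonically increasing on the interval (0, ∞). Consequently, for any real β, there is at most one κ > 0 satisfying the quantization condition β² = cosh κ + sinh κ · coth(N·κ). -/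
open Real in
/-- Addition formula rewriting `cosh + sinh · coth` as a ratio of hyperbolic sines. -/
theorem cosh_add_sinh_mul_coth {x y : ℝ} (hy : 0 < y) :
    cosh x + sinh x * (cosh y / sinh y) = sinh (y + x) / sinh y := by
  have hs : sinh y ≠ 0 := (sinh_pos_iff.2 hy).ne'
  rw [sinh_add]
  field_simp

open Real in
/-- Consecutive ratios `sinh ((n + 1) x) / sinh (n x)` satisfy a Riccati recursion. -/
theorem sinh_ratio_succ (n : ℕ) {x : ℝ} (hx : 0 < x) :
    sinh ((n + 3) * x) / sinh ((n + 2) * x) =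
      2 * cosh x - (sinh ((n + 2) * x) / sinh ((n + 1) * x))⁻¹ := by
  have hs : sinh ((n + 2) * x) ≠ 0 := (sinh_pos_iff.2 (by positivity)).ne'
  have h₁ : ((n : ℝ) + 3) * x = (n + 2) * x + x := by ring
  have h₂ : ((n : ℝ) + 1) * x = (n + 2) * x - x := by ring
  rw [h₁, h₂, inv_div, sinh_add, sinh_sub]
  field_simp
  ring

open Real in
/-- The ratio `sinh ((n + 2) x) / sinh ((n + 1) x)` is strictly increasing on `(0, ∞)`. -/
theorem strictMonoOn_sinh_ratio (n : ℕ) :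
    StrictMonoOn (fun x : ℝ => sinh ((n + 2) * x) / sinh ((n + 1) * x)) (Set.Ioi 0) := by
  have hcosh {x y : ℝ} (hx : 0 < x) (hxy : x < y) : cosh x < cosh y :=
    cosh_strictMonoOn hx.le (hx.trans hxy).le hxy
  induction n with
  | zero =>
    intro x hx y hy hxy
    have h {z : ℝ} (hz : 0 < z) : sinh (2 * z) / sinh z = 2 * cosh z := by
      have hs : sinh z ≠ 0 := (sinh_pos_iff.2 hz).ne'
      rw [sinh_two_mul]
      field_simp
    simp only [Nat.cast_zero, zero_add, one_mul]
    rw [h hx, h hy]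
    linarith [hcosh hx hxy]
  | succ n ih =>
    intro x hx y hy hxy
    have hx' : 0 < x := hx
    have hpos : 0 < sinh ((n + 2) * x) / sinh ((n + 1) * x) :=
      div_pos (sinh_pos_iff.2 (by positivity)) (sinh_pos_iff.2 (by positivity))
    have hinv := inv_strictAnti₀ hpos (ih hx hy hxy)
    have h₁ : ((n + 1 : ℕ) : ℝ) + 2 = n + 3 := by push_cast; ring
    have h₂ : ((n + 1 : ℕ) : ℝ) + 1 = n + 2 := by push_cast; ring
    simp only [h₁, h₂]
    rw [sinh_ratio_succ n hx, sinh_ratio_succ n hy]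
    linarith [hcosh hx hxy]

/-- The function `κ ↦ cosh κ + sinh κ · coth (N κ)` is strictly monotonically increasing
on `(0, ∞)`; consequently, for every `β` there is at most one `κ > 0` satisfying the
quantization condition `β² = cosh κ + sinh κ · coth (N κ)`. -/
theorem quantization_function_strictMono (N : ℕ) (hN : 1 ≤ N) :
    StrictMonoOn
      (fun κ : ℝ => Real.cosh κ +
        Real.sinh κ * (Real.cosh ((N : ℝ) * κ) / Real.sinh ((N : ℝ) * κ)))
      (Set.Ioi (0 : ℝ)) ∧
    ∀ β κ₁ κ₂ : ℝ, 0 < κ₁ → 0 < κ₂ →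
      β ^ 2 = Real.cosh κ₁ +
        Real.sinh κ₁ * (Real.cosh ((N : ℝ) * κ₁) / Real.sinh ((N : ℝ) * κ₁)) →
      β ^ 2 = Real.cosh κ₂ +
        Real.sinh κ₂ * (Real.cosh ((N : ℝ) * κ₂) / Real.sinh ((N : ℝ) * κ₂)) →
      κ₁ = κ₂ := by
  have hmono : StrictMonoOn
      (fun κ : ℝ => Real.cosh κ +
        Real.sinh κ * (Real.cosh ((N : ℝ) * κ) / Real.sinh ((N : ℝ) * κ)))
      (Set.Ioi (0 : ℝ)) := by
    obtain ⟨n, rfl⟩ := Nat.exists_eq_add_of_le' hN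
    refine (strictMonoOn_sinh_ratio n).congr fun x hx => ?_
    have hx' : 0 < x := hx
    dsimp only
    rw [cosh_add_sinh_mul_coth (by positivity)]
    push_cast
    congr 2
    ring
  exact ⟨hmono, fun β κ₁ κ₂ h₁ h₂ e₁ e₂ => hmono.injOn h₁ h₂ (e₁.symm.trans e₂)⟩
end

section
/- Let κ > 0 be real and L ≥ 0 an integer. Then 2·sinh((L+1)·κ)² / ( sinh((2L+5)·κ)/sinh(κ) − (2L+5) ) ≥ sinh(κ)·( e^{−3κ} − 2·e^{−(2L+5)κ} ) ≥ sinh(κ)·e^{−3κ}·(1 − 2·e^{−2κ}). In particular, for κ ≥ log(2+√3) the left-hand side is bounded below by a positive constant independent of L. -/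
theorem nat_mul_sinh_le_sinh_nat_mul {x : ℝ} (hx : 0 ≤ x) (n : ℕ) :
    n * Real.sinh x ≤ Real.sinh (n * x) := by
  induction n with
  | zero => simp
  | succ n ih =>
    have hs : 0 ≤ Real.sinh x := Real.sinh_nonneg_iff.2 hx
    have hn : 0 ≤ Real.sinh (n * x) := Real.sinh_nonneg_iff.2 (by positivity)
    push_cast
    rw [add_one_mul, add_one_mul, Real.sinh_add]
    nlinarith [mul_le_mul_of_nonneg_left (Real.one_le_cosh x) hn,
      mul_le_mul_of_nonneg_right (Real.one_le_cosh (n * x)) hs]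

theorem nat_mul_sinh_lt_sinh_nat_mul {x : ℝ} (hx : 0 < x) {n : ℕ} (hn : 2 ≤ n) :
    n * Real.sinh x < Real.sinh (n * x) := by
  obtain ⟨m, rfl⟩ : ∃ m, n = m + 1 := ⟨n - 1, by omega⟩
  have hm : (0 : ℝ) < m := by exact_mod_cast (by omega : 0 < m)
  have hs : 0 < Real.sinh x := Real.sinh_pos_iff.2 hx
  have hms : 0 ≤ Real.sinh (m * x) := Real.sinh_nonneg_iff.2 (by positivity)
  have hc : 1 < Real.cosh (m * x) := Real.one_lt_cosh.2 (by positivity)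
  push_cast
  rw [add_one_mul, add_one_mul, Real.sinh_add]
  nlinarith [mul_le_mul_of_nonneg_left (Real.one_le_cosh x) hms,
    mul_lt_mul_of_pos_right hc hs, nat_mul_sinh_le_sinh_nat_mul hx.le m]

theorem sinh_mul_exp_sub_le_two_mul_sinh_sq {x y : ℝ} (hx : 0 ≤ x) (hy : 0 ≤ y) :
    Real.sinh (2 * x + 3 * y) * (Real.exp (-3 * y) - 2 * Real.exp (-(2 * x + 3 * y))) ≤
      2 * Real.sinh x ^ 2 := by
  have hxy : Real.exp (-(2 * x + 3 * y)) = Real.exp (-x) ^ 2 * Real.exp (-3 * y) := by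
    rw [← Real.exp_nat_mul, ← Real.exp_add]
    push_cast
    ring_nf
  have hxy' : Real.exp (2 * x + 3 * y) = Real.exp x ^ 2 * Real.exp (3 * y) := by
    rw [← Real.exp_nat_mul, ← Real.exp_add]
    push_cast
    ring_nf
  have hinvx : Real.exp x * Real.exp (-x) = 1 := by rw [← Real.exp_add]; simp
  have hinvy : Real.exp (3 * y) * Real.exp (-3 * y) = 1 := by rw [← Real.exp_add]; simp
  rw [Real.sinh_eq, Real.sinh_eq, hxy, hxy']
  have hp : Real.exp (-x) ≤ 1 := Real.exp_le_one_iff.2 (by linarith)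
  have hq : Real.exp (-3 * y) ≤ 1 := Real.exp_le_one_iff.2 (by linarith)
  have hp0 := Real.exp_pos (-x)
  have hq0 := Real.exp_pos (-3 * y)
  generalize Real.exp (-x) = p at *
  generalize Real.exp (-3 * y) = q at *
  generalize Real.exp x = a at *
  generalize Real.exp (3 * y) = b at *
  have key : 2 * ((a - p) / 2) ^ 2 - (a ^ 2 * b - p ^ 2 * q) / 2 * (q - 2 * (p ^ 2 * q)) =
      p ^ 2 * (1 + q ^ 2 - 2 * p ^ 2 * q ^ 2) / 2 := by
    linear_combination (-a ^ 2 / 2 + a ^ 2 * p ^ 2) * hinvy + a * p * hinvx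
  have hq2 : q ^ 2 ≤ 1 := pow_le_one₀ hq0.le hq
  have hp2 : p ^ 2 ≤ 1 := pow_le_one₀ hp0.le hp
  have : 0 ≤ 1 + q ^ 2 - 2 * p ^ 2 * q ^ 2 := by
    nlinarith [mul_le_mul_of_nonneg_right hp2 (sq_nonneg q)]
  have : 0 ≤ p ^ 2 * (1 + q ^ 2 - 2 * p ^ 2 * q ^ 2) / 2 := by positivity
  linarith

theorem sinh_mul_exp_sub_le_readout_overlap {κ : ℝ} (hκ : 0 < κ) (L : ℕ) :
    Real.sinh κ * (Real.exp (-3 * κ) - 2 * Real.exp (-((2 * (L : ℝ) + 5) * κ))) ≤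
      2 * Real.sinh (((L : ℝ) + 1) * κ) ^ 2 /
        (Real.sinh ((2 * (L : ℝ) + 5) * κ) / Real.sinh κ - (2 * (L : ℝ) + 5)) := by
  have hs : 0 < Real.sinh κ := Real.sinh_pos_iff.2 hκ
  have hS : 0 < Real.sinh ((2 * (L : ℝ) + 5) * κ) := Real.sinh_pos_iff.2 (by positivity)
  have hlt := nat_mul_sinh_lt_sinh_nat_mul hκ (n := 2 * L + 5) (by omega)
  push_cast at hlt
  have hD : 0 < Real.sinh ((2 * (L : ℝ) + 5) * κ) / Real.sinh κ - (2 * (L : ℝ) + 5) :=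
    sub_pos.2 ((lt_div_iff₀ hs).2 hlt)
  calc _ ≤ 2 * Real.sinh (((L : ℝ) + 1) * κ) ^ 2 /
        (Real.sinh ((2 * (L : ℝ) + 5) * κ) / Real.sinh κ) := by
        have h := sinh_mul_exp_sub_le_two_mul_sinh_sq (x := ((L : ℝ) + 1) * κ)
          (by positivity) hκ.le
        rw [show 2 * (((L : ℝ) + 1) * κ) + 3 * κ = (2 * (L : ℝ) + 5) * κ by ring] at h
        rw [div_div_eq_mul_div, le_div_iff₀ hS]
        linarith [mul_le_mul_of_nonneg_left h hs.le]
    _ ≤ _ := div_le_div_of_nonneg_left (by positivity) hD (by linarith [L.cast_nonneg (α := ℝ)])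

theorem sinh_mul_exp_mul_le_sinh_mul_exp_sub {κ : ℝ} (hκ : 0 ≤ κ) (L : ℕ) :
    Real.sinh κ * Real.exp (-3 * κ) * (1 - 2 * Real.exp (-2 * κ)) ≤
      Real.sinh κ * (Real.exp (-3 * κ) - 2 * Real.exp (-((2 * (L : ℝ) + 5) * κ))) := by
  rw [mul_assoc]
  refine mul_le_mul_of_nonneg_left ?_ (Real.sinh_nonneg_iff.2 hκ)
  have h : Real.exp (-((2 * (L : ℝ) + 5) * κ)) ≤ Real.exp (-3 * κ) * Real.exp (-2 * κ) := by
    rw [← Real.exp_add, Real.exp_le_exp]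
    nlinarith [mul_nonneg (L.cast_nonneg (α := ℝ)) hκ]
  linarith

/-- Lower bound on the bound-state weight on the read-out clock site:
`2 sinh((L+1)κ)² / (sinh((2L+5)κ)/sinh κ - (2L+5)) ≥ sinh κ (e^{-3κ} - 2 e^{-(2L+5)κ})
≥ sinh κ · e^{-3κ} (1 - 2 e^{-2κ})`; for `κ ≥ log(2+√3)` the left-hand side is bounded
below by a positive constant independent of `L`. -/
theorem bound_state_readout_overlap (κ : ℝ) (hκ : 0 < κ) (L : ℕ) :
    (Real.sinh κ * (Real.exp (-3 * κ) - 2 * Real.exp (-((2 * (L : ℝ) + 5) * κ))) ≤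
      2 * Real.sinh (((L : ℝ) + 1) * κ) ^ 2 /
        (Real.sinh ((2 * (L : ℝ) + 5) * κ) / Real.sinh κ - (2 * (L : ℝ) + 5))) ∧
    (Real.sinh κ * Real.exp (-3 * κ) * (1 - 2 * Real.exp (-2 * κ)) ≤
      Real.sinh κ * (Real.exp (-3 * κ) - 2 * Real.exp (-((2 * (L : ℝ) + 5) * κ)))) ∧
    (Real.log (2 + Real.sqrt 3) ≤ κ →
      ∃ c : ℝ, 0 < c ∧ ∀ L' : ℕ,
        c ≤ 2 * Real.sinh (((L' : ℝ) + 1) * κ) ^ 2 /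
          (Real.sinh ((2 * (L' : ℝ) + 5) * κ) / Real.sinh κ - (2 * (L' : ℝ) + 5))) := by
  refine ⟨sinh_mul_exp_sub_le_readout_overlap hκ L,
    sinh_mul_exp_mul_le_sinh_mul_exp_sub hκ.le L, fun h => ?_⟩
  refine ⟨Real.sinh κ * Real.exp (-3 * κ) * (1 - 2 * Real.exp (-2 * κ)), ?_, fun L' =>
    (sinh_mul_exp_mul_le_sinh_mul_exp_sub hκ.le L').trans
      (sinh_mul_exp_sub_le_readout_overlap hκ L')⟩
  have hs : 0 < Real.sinh κ := Real.sinh_pos_iff.2 hκ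
  have he : 2 ≤ Real.exp κ := by
    have := (Real.log_le_iff_le_exp (by positivity)).1 h
    linarith [Real.sqrt_nonneg 3]
  have h1 : Real.exp (-2 * κ) * Real.exp κ ^ 2 = 1 := by
    rw [← Real.exp_nat_mul, ← Real.exp_add]
    simp
  have h2 : 0 < 1 - 2 * Real.exp (-2 * κ) := by
    nlinarith [Real.exp_pos (-2 * κ), pow_le_pow_left₀ zero_le_two he 2]
  positivity
end
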